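/- arXiv:2103.14116 — 2 statements merged into one kernel-verified Lean document; each statement's English description precedes it below -/
import Mathlib

section
/- Every crystallographic group Γ (a cocompact discrete subgroup of E(n)) has vanishing stable torsion length: the subgroup of Γ generated by torsion elements is boundedly generated by torsion elements, so stl_Γ(g) = 0 for all g in that subgroup. -/
/-- Word length of `g` with respect to a generating set `S`:
the least `k` such that `g` is a product of `k` elements of `S`. -/
noncomputable def wl {G : Type*} [Group G] (S : Set G) (g : G) : ℕ :=
  sInf {k | ∃ l : List G, (∀ x ∈ l, x ∈ S) ∧ l.length = k ∧ l.prod = g}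

/-- Stable word length of `g` with respect to `S`, defined as the infimum of
`|g^n|_S / n` (which equals the limit by Fekete's lemma). -/
noncomputable def swl {G : Type*} [Group G] (S : Set G) (g : G) : ℝ :=
  ⨅ n : ℕ+, (wl S (g ^ (n : ℕ)) : ℝ) / (n : ℕ)


/-- `g` is a product of at most `k` torsion elements. -/
def TB {G : Type*} [Group G] (k : ℕ) (g : G) : Prop :=
  ∃ l : List G, (∀ x ∈ l, IsOfFinOrder x) ∧ l.length ≤ k ∧ l.prod = g

section grp
variable {G : Type*} [Group G]

lemma TB.one (k : ℕ) : TB k (1 : G) := ⟨[], by simp, by simp, by simp⟩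

lemma TB.mul {j k : ℕ} {g h : G} (hg : TB j g) (hh : TB k h) : TB (j + k) (g * h) := by
  obtain ⟨l, h1, h2, h3⟩ := hg
  obtain ⟨m, h4, h5, h6⟩ := hh
  refine ⟨l ++ m, ?_, by simp; omega, by simp [h3, h6]⟩
  intro x hx
  rcases List.mem_append.1 hx with h | h
  · exact h1 x h
  · exact h4 x h

lemma TB.mono {j k : ℕ} {g : G} (hg : TB j g) (h : j ≤ k) : TB k g := by
  obtain ⟨l, h1, h2, h3⟩ := hg
  exact ⟨l, h1, h2.trans h, h3⟩

lemma TB.of {g : G} (hg : IsOfFinOrder g) : TB 1 g := ⟨[g], by simpa using hg, by simp, by simp⟩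

lemma isOfFinOrder_conj' {t : G} (ht : IsOfFinOrder t) (a : G) : IsOfFinOrder (a * t * a⁻¹) :=
  (MulAut.conj a).toMonoidHom.isOfFinOrder ht

lemma TB.conj {k : ℕ} {g : G} (hg : TB k g) (a : G) : TB k (a * g * a⁻¹) := by
  obtain ⟨l, h1, h2, h3⟩ := hg
  refine ⟨l.map (MulAut.conj a), ?_, by simpa using h2, ?_⟩
  · intro x hx
    obtain ⟨y, hy, rfl⟩ := List.mem_map.1 hx
    exact isOfFinOrder_conj' (h1 y hy) a
  · rw [← map_list_prod, h3]; rfl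

/-- all powers of `g` have uniformly bounded torsion length. -/
def Good (g : G) : Prop := ∃ M, ∀ n : ℤ, TB M (g ^ n)

lemma Good.one : Good (1 : G) := ⟨0, fun n => by simpa using TB.one 0⟩

lemma Good.inv {g : G} (h : Good g) : Good g⁻¹ := by
  obtain ⟨M, hM⟩ := h
  exact ⟨M, fun n => by rw [inv_zpow']; exact hM _⟩

lemma Good.mul {g h : G} (hg : Good g) (hh : Good h) (hc : Commute g h) : Good (g * h) := by
  obtain ⟨M, hM⟩ := hg
  obtain ⟨N, hN⟩ := hh
  exact ⟨M + N, fun n => by rw [hc.mul_zpow]; exact (hM n).mul (hN n)⟩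

lemma Good.conj {g : G} (hg : Good g) (a : G) : Good (a * g * a⁻¹) := by
  obtain ⟨M, hM⟩ := hg
  exact ⟨M, fun n => by rw [conj_zpow]; exact (hM n).conj a⟩

lemma Good.root {g : G} (htb : ∀ g : G, ∃ k, TB k g) {m : ℕ} (hm : 0 < m)
    (hg : Good (g ^ m)) : Good g := by
  obtain ⟨M, hM⟩ := hg
  choose f hf using htb
  refine ⟨M + ∑ r ∈ Finset.range m, f (g ^ r), fun n => ?_⟩
  have h1 : g ^ n = (g ^ m) ^ (n / m) * g ^ (n % m).toNat := by
    rw [← zpow_natCast g m, ← zpow_mul, ← zpow_natCast g (n % m).toNat, ← zpow_add,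
      Int.toNat_of_nonneg (Int.emod_nonneg _ (by omega)), Int.mul_ediv_add_emod]
  rw [h1]
  refine (hM _).mul ((hf _).mono ?_)
  refine Finset.single_le_sum (f := fun r => f (g ^ r)) (fun _ _ => Nat.zero_le _) ?_
  have := Int.emod_lt_of_pos n (show (0 : ℤ) < m by omega)
  have := Int.emod_nonneg n (show (m : ℤ) ≠ 0 by omega)
  rw [Finset.mem_range]; omega

lemma exists_TB (hT : Subgroup.closure {x : G | IsOfFinOrder x} = ⊤) (g : G) : ∃ k, TB k g := by
  have hg : g ∈ Subgroup.closure {x : G | IsOfFinOrder x} := by rw [hT]; trivial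
  induction hg using Subgroup.closure_induction with
  | mem x hx => exact ⟨1, TB.of hx⟩
  | one => exact ⟨0, TB.one 0⟩
  | mul x y _ _ hx hy =>
    obtain ⟨j, hj⟩ := hx
    obtain ⟨k, hk⟩ := hy
    exact ⟨_, hj.mul hk⟩
  | inv x _ hx =>
    obtain ⟨j, l, h1, h2, h3⟩ := hx
    refine ⟨j, (l.map (·⁻¹)).reverse, ?_, by simpa using h2, ?_⟩
    · intro y hy
      simp only [List.mem_reverse, List.mem_map] at hy
      obtain ⟨z, hz, rfl⟩ := hy
      exact (h1 z hz).inv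
    · rw [← h3, List.prod_inv_reverse]

lemma closure_TB (A : Subgroup G) (hc : ∀ a ∈ A, ∀ b ∈ A, a * b = b * a) (X : Finset G)
    (hX : ∀ x ∈ X, x ∈ A ∧ Good x) :
    ∃ M, ∀ g ∈ Subgroup.closure (X : Set G), TB M g := by
  classical
  induction X using Finset.induction_on with
  | empty => exact ⟨0, fun g hg => by
      simp at hg; subst hg; exact TB.one 0⟩
  | insert x X hx ih =>
    obtain ⟨M, hM⟩ := ih (fun y hy => hX y (Finset.mem_insert_of_mem hy))
    obtain ⟨hxA, N, hN⟩ := hX x (Finset.mem_insert_self _ _)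
    have hle : Subgroup.closure (X : Set G) ≤ A :=
      (Subgroup.closure_le _).2 fun y hy => (hX y (Finset.mem_insert_of_mem hy)).1
    refine ⟨N + M, fun g hg => ?_⟩
    suffices h : ∃ n : ℤ, ∃ y ∈ Subgroup.closure (X : Set G), g = x ^ n * y by
      obtain ⟨n, y, hy, rfl⟩ := h
      exact (hN n).mul (hM y hy)
    induction hg using Subgroup.closure_induction with
    | mem z hz =>
      rcases Finset.mem_insert.1 hz with rfl | hz
      · exact ⟨1, 1, one_mem _, by simp⟩
      · exact ⟨0, z, Subgroup.subset_closure hz, by simp⟩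
    | one => exact ⟨0, 1, one_mem _, by simp⟩
    | mul a b _ _ ha hb =>
      obtain ⟨n, y, hy, rfl⟩ := ha
      obtain ⟨m, z, hz, rfl⟩ := hb
      refine ⟨n + m, y * z, mul_mem hy hz, ?_⟩
      have := hc y (hle hy) (x ^ m) (zpow_mem hxA m)
      rw [zpow_add, mul_assoc, ← mul_assoc y, this]; simp only [mul_assoc]
    | inv a _ ha =>
      obtain ⟨n, y, hy, rfl⟩ := ha
      refine ⟨-n, y⁻¹, inv_mem hy, ?_⟩
      rw [hc _ (zpow_mem hxA n) y (hle hy), mul_inv_rev, zpow_neg]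

lemma torsion_quot (A C : Subgroup G) [C.Normal] [A.FiniteIndex]
    (hT : Subgroup.closure {x : G | IsOfFinOrder x} = ⊤)
    (h : ∀ t : G, IsOfFinOrder t → ∀ a ∈ A, t * a * t⁻¹ * a⁻¹ ∈ C) (g : G) :
    ∃ m : ℕ, 0 < m ∧ g ^ m ∈ C := by
  have hT' : ∀ g : G, g ∈ Subgroup.closure {x : G | IsOfFinOrder x} := fun g => by
    rw [hT]; trivial
  let π := QuotientGroup.mk' C
  have hcen : A.map π ≤ Subgroup.center (G ⧸ C) := by
    rintro _ ⟨a, ha, rfl⟩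
    rw [Subgroup.mem_center_iff]
    intro q
    obtain ⟨x, rfl⟩ := QuotientGroup.mk'_surjective C q
    induction hT' x using Subgroup.closure_induction with
    | mem t ht =>
      have h1 : π (t * a * t⁻¹ * a⁻¹) = 1 := (QuotientGroup.eq_one_iff _).2 (h t ht a ha)
      simp only [map_mul, map_inv] at h1
      change π t * π a = π a * π t
      rw [mul_inv_eq_one, mul_inv_eq_iff_eq_mul] at h1
      exact h1
    | one => simp
    | mul x y _ _ hx hy =>
      simp only [map_mul]
      rw [mul_assoc, hy, ← mul_assoc, hx, mul_assoc]
    | inv x _ hx =>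
      rw [map_inv]
      exact ((show Commute _ _ from hx).inv_left)
  have hfi : (A.map π).FiniteIndex := by
    constructor
    have := Subgroup.index_map_dvd A (f := π) (QuotientGroup.mk'_surjective C)
    exact fun h0 => Subgroup.FiniteIndex.index_ne_zero (H := A) (by simpa [h0] using this)
  have : (Subgroup.center (G ⧸ C)).FiniteIndex := Subgroup.finiteIndex_of_le hcen
  have key : IsOfFinOrder (MonoidHom.transferCenterPow (G ⧸ C) (π g)) := by
    induction hT' g using Subgroup.closure_induction with
    | mem t ht => exact MonoidHom.isOfFinOrder _ (π.isOfFinOrder ht)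
    | one => simp
    | mul x y _ _ hx hy =>
      simp only [map_mul]
      refine Commute.isOfFinOrder_mul (Subtype.ext ?_) hx hy
      exact (Subgroup.mem_center_iff.1 (MonoidHom.transferCenterPow (G ⧸ C) (π y)).2 _)
    | inv x _ hx => simpa using hx
  have key2 := (Subgroup.subtype _).isOfFinOrder key
  simp only [Subgroup.subtype_apply, MonoidHom.transferCenterPow_apply] at key2
  obtain ⟨k, hk, hk2⟩ := isOfFinOrder_iff_pow_eq_one.1 key2
  refine ⟨(Subgroup.center (G ⧸ C)).index * k,
    Nat.mul_pos (Nat.pos_of_ne_zero Subgroup.FiniteIndex.index_ne_zero) hk, ?_⟩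
  rw [← QuotientGroup.eq_one_iff, pow_mul]
  exact hk2

lemma bounded_of_gen (A : Subgroup G) [A.Normal] [A.FiniteIndex] (hfg : A.FG)
    (hc : ∀ a ∈ A, ∀ b ∈ A, a * b = b * a)
    (hT : Subgroup.closure {x : G | IsOfFinOrder x} = ⊤) : ∃ M, ∀ g : G, TB M g := by
  let S : Set G := {x | ∃ t a, IsOfFinOrder t ∧ a ∈ A ∧ x = t * a * t⁻¹ * a⁻¹}
  let C := Subgroup.normalClosure S
  have hS : ∀ x ∈ S, x ∈ A ∧ Good x := by
    rintro _ ⟨t, a, ht, ha, rfl⟩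
    have h1 : t * a * t⁻¹ ∈ A := Subgroup.Normal.conj_mem inferInstance a ha t
    refine ⟨mul_mem h1 (inv_mem ha), 2, fun n => ?_⟩
    have hcc : Commute (t * a * t⁻¹) a⁻¹ := hc _ h1 _ (inv_mem ha)
    rw [hcc.mul_zpow, conj_zpow, inv_zpow]
    have : t * a ^ n * t⁻¹ * (a ^ n)⁻¹ = t * (a ^ n * t⁻¹ * (a ^ n)⁻¹) := by group
    rw [this]
    exact (TB.of ht).mul (TB.of (isOfFinOrder_conj' ht.inv _))
  have hC : ∀ x ∈ C, x ∈ A ∧ Good x := by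
    intro x hx
    change x ∈ Subgroup.closure _ at hx
    induction hx using Subgroup.closure_induction with
    | mem y hy =>
      obtain ⟨z, hz, hzy⟩ := Group.mem_conjugatesOfSet_iff.1 hy
      obtain ⟨c, rfl⟩ := isConj_iff.1 hzy
      obtain ⟨h1, h2⟩ := hS z hz
      exact ⟨Subgroup.Normal.conj_mem inferInstance z h1 c, h2.conj c⟩
    | one => exact ⟨one_mem _, Good.one⟩
    | mul x y _ _ hx hy => exact ⟨mul_mem hx.1 hy.1, hx.2.mul hy.2 (hc _ hx.1 _ hy.1)⟩
    | inv x _ hx => exact ⟨inv_mem hx.1, hx.2.inv⟩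
  have htb := exists_TB hT
  have hgood : ∀ g : G, Good g := by
    intro g
    obtain ⟨m, hm, hgm⟩ := torsion_quot A C hT
      (fun t ht a ha => Subgroup.subset_normalClosure ⟨t, a, ht, ha, rfl⟩) g
    exact Good.root htb hm (hC _ hgm).2
  obtain ⟨X, rfl⟩ := hfg
  obtain ⟨M, hM⟩ := closure_TB _ hc X
    (fun x hx => ⟨Subgroup.subset_closure hx, hgood x⟩)
  choose f hf using htb
  have : Fintype (G ⧸ Subgroup.closure (X : Set G)) := Fintype.ofFinite _
  refine ⟨(∑ q : G ⧸ Subgroup.closure (X : Set G), f q.out) + M, fun g => ?_⟩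
  have h1 : g = (g : G ⧸ Subgroup.closure (X : Set G)).out *
    ((g : G ⧸ Subgroup.closure (X : Set G)).out⁻¹ * g) := by group
  rw [h1]
  refine ((hf _).mono ?_).mul (hM _ ?_)
  · exact Finset.single_le_sum (f := fun q : G ⧸ Subgroup.closure (X : Set G) => f q.out)
      (fun _ _ => Nat.zero_le _) (Finset.mem_univ _)
  · rw [← QuotientGroup.eq]; simp

lemma fg_sub_comm {N : Type*} [CommGroup N] [Group.FG N] (K : Subgroup N) : Group.FG K := by
  have : Module.Finite ℤ (Additive N) := Module.Finite.iff_addGroup_fg.2 inferInstance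
  have h : (AddSubgroup.toIntSubmodule (Subgroup.toAddSubgroup K)).FG := IsNoetherian.noetherian _
  have h2 : Module.Finite ℤ (AddSubgroup.toIntSubmodule (Subgroup.toAddSubgroup K)) :=
    Module.Finite.iff_fg.2 h
  have h3 : AddGroup.FG (AddSubgroup.toIntSubmodule (Subgroup.toAddSubgroup K)) :=
    Module.Finite.iff_addGroup_fg.1 h2
  rw [GroupFG.iff_add_fg]
  exact h3

lemma bounded_closure [Group.FG G] (N : Subgroup G) [N.Normal] [N.FiniteIndex]
    (hc : ∀ a ∈ N, ∀ b ∈ N, a * b = b * a) :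
    ∃ M, ∀ g ∈ Subgroup.closure {x : G | IsOfFinOrder x}, TB M g := by
  set T := Subgroup.closure {x : G | IsOfFinOrder x} with hTdef
  have hfg : (N.subgroupOf T).FG := by
    let _ : CommGroup N := { (inferInstance : Group N) with
      mul_comm := fun a b => Subtype.ext (hc a a.2 b b.2) }
    have hN : Group.FG N := Subgroup.fg_of_index_ne_zero N
    have h1 : Group.FG (T.subgroupOf N) := fg_sub_comm _
    rw [← Group.fg_iff_subgroup_fg]
    let f : T.subgroupOf N →* N.subgroupOf T :=
      { toFun := fun x => ⟨⟨x.1.1, x.2⟩, x.1.2⟩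
        map_one' := rfl
        map_mul' := fun _ _ => rfl }
    exact Group.fg_of_surjective (f := f) (fun y => ⟨⟨⟨y.1.1, y.2⟩, y.1.2⟩, rfl⟩)
  have htop : Subgroup.closure {x : T | IsOfFinOrder x} = ⊤ := by
    have h := Subgroup.closure_closure_coe_preimage (k := {x : G | IsOfFinOrder x})
    rw [← h]
    congr 1
    ext x
    exact Iff.symm <| Submonoid.isOfFinOrder_coe (H := T.toSubmonoid) (x := x)
  obtain ⟨M, hM⟩ := bounded_of_gen (N.subgroupOf T) hfg
    (fun a ha b hb => Subtype.ext (hc a ha b hb)) htop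
  refine ⟨M, fun g hg => ?_⟩
  obtain ⟨l, h1, h2, h3⟩ := hM ⟨g, hg⟩
  refine ⟨l.map T.subtype, ?_, by simpa using h2, ?_⟩
  · intro x hx
    obtain ⟨y, hy, rfl⟩ := List.mem_map.1 hx
    exact T.subtype.isOfFinOrder (h1 y hy)
  · rw [← map_list_prod, h3]; rfl

end grp

section geo
variable {E : Type*} [NormedAddCommGroup E] [InnerProductSpace ℝ E]

/-- linear part -/
noncomputable def linPart (g : E ≃ᵢ E) : E ≃ₗᵢ[ℝ] E := g.toRealLinearIsometryEquiv

lemma linPart_add (g : E ≃ᵢ E) (x : E) : g x = linPart g x + g 0 := by simp [linPart]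

lemma linPart_mul (g h : E ≃ᵢ E) (x : E) : linPart (g * h) x = linPart g (linPart h x) := by
  have h1 : (g * h) x = g (h x) := rfl
  have h2 : (g * h) 0 = g (h 0) := rfl
  have h3 := linPart_add (g * h) x
  rw [h1, h2, linPart_add h x, linPart_add g, linPart_add g (h 0), map_add] at h3
  have h4 : linPart (g * h) x + (linPart g (h 0) + g 0) = linPart g (linPart h x) + (linPart g (h 0) + g 0) := by
    rw [← h3]; abel
  exact add_right_cancel h4

lemma linPart_one (x : E) : linPart (1 : E ≃ᵢ E) x = x := by
  simp [linPart]

/-- the linear part as a homomorphism -/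
noncomputable def linPartHom : (E ≃ᵢ E) →* (E ≃ₗᵢ[ℝ] E) where
  toFun := linPart
  map_one' := by ext x; exact linPart_one x
  map_mul' g h := by ext x; exact linPart_mul g h x

/-- The linear part is `ε`-near the identity. -/
def Near (g : E ≃ᵢ E) (ε : ℝ) : Prop := ∀ x, ‖linPart g x - x‖ ≤ ε * ‖x‖

lemma near_comm {g h : E ≃ᵢ E} {a b : ℝ} (ha : 0 ≤ a) (hb : 0 ≤ b)
    (hg : Near g a) (hh : Near h b) : Near (g * h * g⁻¹ * h⁻¹) (2 * a * b) := by
  intro x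
  obtain ⟨y, rfl⟩ : ∃ y, linPart (h * g) y = x := (linPart (h * g)).surjective x
  have h1 : linPart (g * h * g⁻¹ * h⁻¹) (linPart (h * g) y) = linPart g (linPart h y) := by
    rw [← linPart_mul, ← linPart_mul]; congr 2; group
  have h2 : linPart g (linPart h y) - linPart h (linPart g y) =
      (linPart g (linPart h y - y) - (linPart h y - y)) - (linPart h (linPart g y - y) - (linPart g y - y)) := by
    simp only [map_sub]; abel
  rw [h1, LinearIsometryEquiv.norm_map, linPart_mul h g, h2]
  have h3 := hg (linPart h y - y)
  have h4 := hh (linPart g y - y)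
  have h5 := mul_le_mul_of_nonneg_left (hh y) ha
  have h6 := mul_le_mul_of_nonneg_left (hg y) hb
  refine (norm_sub_le _ _).trans ?_
  linarith

lemma exists_bound_below [FiniteDimensional ℝ E] (A : E ≃ₗᵢ[ℝ] E) :
    ∃ c : ℝ, 0 < c ∧ ∀ x, c * ‖A x - x‖ ≤ ‖A (A x - x) - (A x - x)‖ := by
  let T : E →ₗ[ℝ] E := (A.toLinearEquiv : E →ₗ[ℝ] E) - LinearMap.id
  have hT : ∀ x, T x = A x - x := fun x => rfl
  let f : LinearMap.range T →ₗ[ℝ] E := T.domRestrict (LinearMap.range T)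
  have hf : LinearMap.ker f = ⊥ := by
    rw [LinearMap.ker_eq_bot']
    rintro ⟨_, y, rfl⟩ hy
    have h1 : T (T y) = 0 := hy
    set x := T y with hx
    have h2 : A x = x := by rw [hT] at h1; exact sub_eq_zero.1 h1
    have h3 : inner ℝ x x = (0 : ℝ) := by
      nth_rewrite 1 [hx]
      rw [hT, inner_sub_left]
      nth_rewrite 1 [← h2]
      rw [LinearIsometryEquiv.inner_map_map, sub_self]
    exact Subtype.ext (inner_self_eq_zero.1 h3)
  obtain ⟨K, hK, hK2⟩ := f.exists_antilipschitzWith hf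
  refine ⟨(K : ℝ)⁻¹, by positivity, fun x => ?_⟩
  have h := hK2.le_mul_dist ⟨T x, x, rfl⟩ 0
  rw [map_zero, dist_zero_right, dist_zero_right] at h
  have h' : ‖A x - x‖ ≤ K * ‖A (A x - x) - (A x - x)‖ := h
  have hK' : (0 : ℝ) < K := by exact_mod_cast hK
  rw [inv_mul_le_iff₀ hK']
  exact h'

lemma subseq_near [FiniteDimensional ℝ E] (β : ℕ → (E ≃ᵢ E)) {ε : ℝ} (hε : 0 < ε) :
    ∃ φ : ℕ → ℕ, StrictMono φ ∧ ∀ i j, Near (β (φ j) * (β (φ i))⁻¹) ε := by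
  let F : ℕ → (E →L[ℝ] E) := fun k => ((linPart (β k)).toContinuousLinearEquiv : E →L[ℝ] E)
  have hF : ∀ k x, F k x = linPart (β k) x := fun k x => rfl
  have hb : ∀ k, F k ∈ Metric.closedBall (0 : E →L[ℝ] E) 1 := by
    intro k
    rw [mem_closedBall_zero_iff]
    refine ContinuousLinearMap.opNorm_le_bound _ zero_le_one fun x => ?_
    rw [hF, LinearIsometryEquiv.norm_map, one_mul]
  have : ProperSpace (E →L[ℝ] E) := FiniteDimensional.proper ℝ _
  obtain ⟨a, _, φ, hφ, hlim⟩ := (isCompact_closedBall (0 : E →L[ℝ] E) 1).tendsto_subseq hb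
  obtain ⟨N, hN⟩ := Metric.cauchySeq_iff.1 hlim.cauchySeq ε hε
  refine ⟨fun k => φ (N + k), fun i j hij => hφ (by omega), fun i j x => ?_⟩
  have h1 := hN (N + j) (by omega) (N + i) (by omega)
  obtain ⟨y, rfl⟩ := (linPart (β (φ (N + i)))).surjective x
  rw [← linPart_mul, inv_mul_cancel_right, LinearIsometryEquiv.norm_map]
  rw [dist_eq_norm] at h1
  have h2 := (F (φ (N + j)) - F (φ (N + i))).le_of_opNorm_le h1.le y
  exact h2

lemma exists_min (Γ : Subgroup (E ≃ᵢ E)) (hfin : ∀ R : ℝ, {γ : Γ | ‖γ.1 0‖ ≤ R}.Finite)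
    (P : Γ → Prop) (h : ∃ γ, P γ) : ∃ γ, P γ ∧ ∀ γ', P γ' → ‖γ.1 0‖ ≤ ‖γ'.1 0‖ := by
  obtain ⟨γ, hγ⟩ := h
  have hf : {γ' : Γ | P γ' ∧ ‖γ'.1 0‖ ≤ ‖γ.1 0‖}.Finite :=
    (hfin ‖γ.1 0‖).subset fun x hx => hx.2
  obtain ⟨δ, hδ, hmin⟩ := Set.exists_min_image _ (fun γ : Γ => ‖γ.1 0‖) hf ⟨γ, hγ, le_rfl⟩
  refine ⟨δ, hδ.1, fun γ' h' => ?_⟩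
  rcases le_total ‖γ'.1 0‖ ‖γ.1 0‖ with h1 | h1
  · exact hmin γ' ⟨h', h1⟩
  · exact hδ.2.trans h1

lemma exists_dir [FiniteDimensional ℝ E] (Γ : Subgroup (E ≃ᵢ E)) (d : ℝ)
    (hd : ∀ x : E, ∃ γ : Γ, ‖γ.1 0 - x‖ ≤ d) (u : E) {ε : ℝ} (hε : 0 < ε) :
    ∃ D : ℝ, ∀ J : ℝ, ∃ γ : Γ, ∃ j : ℝ, J ≤ j ∧ Near γ.1 ε ∧ ‖γ.1 0 - j • u‖ ≤ D := by
  choose β hβ using fun k : ℕ => hd ((k : ℝ) • u)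
  obtain ⟨φ, hφ, hnear⟩ := subseq_near (fun k => (β k).1) hε
  refine ⟨d + ‖(β (φ 0)).1 0‖, fun J => ?_⟩
  obtain ⟨k, hk⟩ := exists_nat_ge J
  refine ⟨β (φ k) * (β (φ 0))⁻¹, (φ k : ℝ), hk.trans (by exact_mod_cast hφ.le_apply),
    hnear 0 k, ?_⟩
  set g : E ≃ᵢ E := (β (φ k)).1 * ((β (φ 0)).1)⁻¹ with hg
  change ‖g 0 - _‖ ≤ _
  have h1 : g ((β (φ 0)).1 0) = (β (φ k)).1 0 := by
    change (g * (β (φ 0)).1) 0 = _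
    rw [hg, inv_mul_cancel_right]
  rw [linPart_add g] at h1
  have h2 : g 0 - (φ k : ℝ) • u = ((β (φ k)).1 0 - (φ k : ℝ) • u) - linPart g ((β (φ 0)).1 0) := by
    rw [← h1]; abel
  rw [h2]
  refine (norm_sub_le _ _).trans ?_
  rw [LinearIsometryEquiv.norm_map]
  linarith [hβ (φ k)]

lemma comm_trans (g h : E ≃ᵢ E) :
    (g * h * g⁻¹ * h⁻¹) 0 = (linPart g (h 0) - h 0) + ((h 0 - linPart (g * h * g⁻¹ * h⁻¹) (h 0)) +
      (g 0 - linPart (g * h * g⁻¹ * h⁻¹) (linPart h (g 0)))) := by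
  set c := g * h * g⁻¹ * h⁻¹ with hc
  have h1 : c (h (g 0)) = g (h 0) := by
    change (c * h * g) 0 = (g * h) 0
    congr 1; rw [hc]; group
  rw [linPart_add c, linPart_add h (g 0), linPart_add g (h 0), map_add] at h1
  have h2 : c 0 = linPart g (h 0) + g 0 - (linPart c (linPart h (g 0)) + linPart c (h 0)) := by
    rw [← h1]; abel
  rw [h2]; abel

lemma near_half [FiniteDimensional ℝ E] (Γ : Subgroup (E ≃ᵢ E))
    (hfin : ∀ R : ℝ, {γ : Γ | ‖γ.1 0‖ ≤ R}.Finite) (d : ℝ)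
    (hd : ∀ x : E, ∃ γ : Γ, ‖γ.1 0 - x‖ ≤ d) (γ : Γ) (hγ : Near γ.1 (1 / 2)) :
    ∀ x, linPart γ.1 x = x := by
  by_contra hne
  obtain ⟨α, ⟨hα, hα1⟩, hαmin⟩ := exists_min Γ hfin
    (fun γ => Near γ.1 (1 / 2) ∧ ¬ ∀ x, linPart γ.1 x = x) ⟨γ, hγ, hne⟩
  obtain ⟨c, hc, hcT⟩ := exists_bound_below (linPart α.1)
  set A := linPart α.1 with hA
  obtain ⟨κ, hκ, hκ4, hκc⟩ : ∃ κ : ℝ, 0 < κ ∧ κ ≤ 1 / 4 ∧ 2 * κ ≤ c :=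
    ⟨min (1 / 4) (c / 2), by positivity, min_le_left _ _, by
      linarith [min_le_right (1 / 4) (c / 2)]⟩
  have hT : ∀ x, 2 * κ * ‖A x - x‖ ≤ ‖A (A x - x) - (A x - x)‖ := fun x =>
    (mul_le_mul_of_nonneg_right hκc (norm_nonneg _)).trans (hcT x)
  -- the direction
  obtain ⟨w, hw⟩ := not_forall.1 hα1
  have hw0 : A w - w ≠ 0 := sub_ne_zero.2 hw
  have hwn : 0 < ‖A w - w‖ := norm_pos_iff.2 hw0
  set u := ‖A w - w‖⁻¹ • (A w - w) with hu
  have hu1 : ‖u‖ = 1 := by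
    rw [hu, norm_smul, norm_inv, norm_norm, inv_mul_cancel₀ hwn.ne']
  have hTu : 2 * κ ≤ ‖A u - u‖ := by
    have h1 : A u - u = ‖A w - w‖⁻¹ • (A (A w - w) - (A w - w)) := by
      rw [hu, map_smul, ← smul_sub]
    rw [h1, norm_smul, norm_inv, norm_norm, ← div_eq_inv_mul, le_div_iff₀ hwn]
    exact hT w
  set ε := κ ^ 2 / 3 with hεd
  have hε : 0 < ε := by positivity
  have hε48 : ε ≤ 1 / 48 := by rw [hεd]; nlinarith
  have hβex : ∃ β : Γ, Near β.1 ε ∧ β.1 0 ≠ 0 ∧ κ * ‖β.1 0‖ ≤ ‖A (β.1 0) - β.1 0‖ := by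
    obtain ⟨D, hD⟩ := exists_dir Γ d hd u hε
    have hD0 : 0 ≤ D := by
      obtain ⟨γ, j, _, _, h⟩ := hD 0
      exact (norm_nonneg _).trans h
    obtain ⟨β, j, hj, hβ, hb⟩ := hD (D / κ + D + 1)
    have hj0 : 0 ≤ j := le_trans (by positivity) hj
    set r := β.1 0 - j • u with hr
    have hbr : β.1 0 = j • u + r := by rw [hr]; abel
    have hju : ‖j • u‖ = j := by rw [norm_smul, hu1, mul_one, Real.norm_of_nonneg hj0]
    have hDκ : 0 ≤ D / κ := by positivity
    refine ⟨β, hβ, ?_, ?_⟩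
    · intro h0
      rw [h0, eq_comm, add_eq_zero_iff_eq_neg] at hbr
      have : ‖j • u‖ = ‖r‖ := by rw [hbr, norm_neg]
      linarith
    · rw [hbr]
      have h1 : A (j • u + r) - (j • u + r) = j • (A u - u) - (-(A r - r)) := by
        rw [map_add, map_smul, smul_sub]; abel
      have h2 : j * (2 * κ) - 1 / 2 * D ≤ ‖A (j • u + r) - (j • u + r)‖ := by
        rw [h1]
        refine le_trans ?_ (norm_sub_norm_le _ _)
        rw [norm_neg, norm_smul, Real.norm_of_nonneg hj0]
        have h3 := hα r
        have h4 := mul_le_mul_of_nonneg_left hTu hj0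
        rw [← hA] at h3
        linarith
      have h5 : ‖j • u + r‖ ≤ j + D := (norm_add_le _ _).trans (by linarith)
      have h6 := mul_le_mul_of_nonneg_left h5 hκ.le
      have h7 : κ * (D / κ + D + 1) ≤ κ * j := mul_le_mul_of_nonneg_left hj hκ.le
      have h8 : κ * (D / κ) = D := by field_simp
      nlinarith
  obtain ⟨β, ⟨hβ, hb0, hbκ⟩, hβmin⟩ := exists_min Γ hfin
    (fun β => Near β.1 ε ∧ β.1 0 ≠ 0 ∧ κ * ‖β.1 0‖ ≤ ‖A (β.1 0) - β.1 0‖) hβex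
  set b := β.1 0 with hb
  set a := α.1 0 with ha
  have hbn : 0 < ‖b‖ := norm_pos_iff.2 hb0
  let δ : Γ := α * β * α⁻¹ * β⁻¹
  have hδv : δ.1 = α.1 * β.1 * α.1⁻¹ * β.1⁻¹ := rfl
  have hδ : Near δ.1 ε := by
    have := near_comm (by norm_num) hε.le hα hβ
    rw [hδv]; convert this using 1; ring
  set C := linPart δ.1 with hC
  set r := (b - C b) + (a - C (linPart β.1 a)) with hr
  have hδ0 : δ.1 0 = (A b - b) + r := by
    have := comm_trans α.1 β.1
    rw [← hδv] at this
    exact this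
  have hrle : ‖r‖ ≤ 3 * ε * ‖b‖ := by
    by_cases hB : ∀ x, linPart β.1 x = x
    · have hCid : ∀ x, C x = x := by
        intro x
        obtain ⟨y, rfl⟩ := (linPart (β.1 * α.1)).surjective x
        rw [hC, ← linPart_mul, hδv]
        have : α.1 * β.1 * α.1⁻¹ * β.1⁻¹ * (β.1 * α.1) = α.1 * β.1 := by group
        rw [this, linPart_mul, linPart_mul, hB, hB]
      have : r = 0 := by rw [hr, hCid, hCid, hB]; simp
      rw [this, norm_zero]; positivity
    · have hab : ‖a‖ ≤ ‖b‖ := hαmin β ⟨fun x => (hβ x).trans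
        (mul_le_mul_of_nonneg_right (by linarith) (norm_nonneg _)), hB⟩
      have e1 : ‖b - C b‖ ≤ ε * ‖b‖ := by rw [norm_sub_rev]; exact hδ b
      have e2 : ‖a - C (linPart β.1 a)‖ ≤ 2 * ε * ‖a‖ := by
        have : a - C (linPart β.1 a) = -((C (linPart β.1 a) - linPart β.1 a) + (linPart β.1 a - a)) := by abel
        rw [this, norm_neg]
        refine (norm_add_le _ _).trans ?_
        have e3 := hδ (linPart β.1 a)
        rw [LinearIsometryEquiv.norm_map] at e3
        have e4 := hβ a
        linarith
      have e5 := mul_le_mul_of_nonneg_left hab (show 0 ≤ 2 * ε by positivity)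
      refine (norm_add_le _ _).trans ?_
      linarith
  set t := ‖A b - b‖ with ht
  have ht0 : 0 < t := lt_of_lt_of_le (by positivity) hbκ
  have hrt : ‖r‖ ≤ κ * t := by
    have : 3 * ε * ‖b‖ = κ * (κ * ‖b‖) := by rw [hεd]; ring
    rw [this] at hrle
    exact hrle.trans (mul_le_mul_of_nonneg_left hbκ hκ.le)
  have htb : t ≤ 1 / 2 * ‖b‖ := hα b
  have hκt : κ * t ≤ 1 / 4 * t := mul_le_mul_of_nonneg_right hκ4 ht0.le
  have hup : ‖δ.1 0‖ ≤ t + ‖r‖ := by rw [hδ0]; exact norm_add_le _ _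
  have hlow : t - ‖r‖ ≤ ‖δ.1 0‖ := by
    rw [hδ0]
    have := norm_sub_norm_le (A b - b) (-r)
    rwa [norm_neg, sub_neg_eq_add] at this
  have hfinal := hβmin δ ⟨hδ, ?_, ?_⟩
  · linarith
  · intro h0
    rw [h0, norm_zero] at hlow
    linarith
  · have h1 : A (δ.1 0) - δ.1 0 = (A (A b - b) - (A b - b)) - (-(A r - r)) := by
      rw [hδ0, map_add]; abel
    have h2 : 2 * κ * t - 1 / 2 * ‖r‖ ≤ ‖A (δ.1 0) - δ.1 0‖ := by
      rw [h1]
      refine le_trans ?_ (norm_sub_norm_le _ _)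
      rw [norm_neg]
      have h3 := hα r
      have h4 := hT b
      rw [← hA] at h3
      linarith
    have h5 := mul_le_mul_of_nonneg_left hup hκ.le
    have h6 := mul_le_mul_of_nonneg_right hκ4 (norm_nonneg r)
    linarith

lemma group_fg (Γ : Subgroup (E ≃ᵢ E)) (hfin : ∀ R : ℝ, {γ : Γ | ‖γ.1 0‖ ≤ R}.Finite) (d : ℝ)
    (hd : ∀ x : E, ∃ γ : Γ, ‖γ.1 0 - x‖ ≤ d) : Group.FG Γ := by
  have hd0 : 0 ≤ d := by
    obtain ⟨γ, h⟩ := hd 0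
    exact (norm_nonneg _).trans h
  rw [Group.fg_iff]
  refine ⟨{γ : Γ | ‖γ.1 0‖ ≤ 2 * d + 1}, ?_, hfin _⟩
  rw [eq_top_iff]
  suffices h : ∀ k : ℕ, ∀ γ : Γ, ‖γ.1 0‖ ≤ k →
      γ ∈ Subgroup.closure {γ : Γ | ‖γ.1 0‖ ≤ 2 * d + 1} by
    intro γ _
    obtain ⟨k, hk⟩ := exists_nat_ge ‖γ.1 0‖
    exact h k γ hk
  intro k
  induction k with
  | zero =>
    intro γ hγ
    refine Subgroup.subset_closure ?_
    change ‖γ.1 0‖ ≤ _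
    push_cast at hγ
    linarith
  | succ k ih =>
    intro γ hγ
    by_cases hs : ‖γ.1 0‖ ≤ 2 * d + 1
    · exact Subgroup.subset_closure hs
    push Not at hs
    set g := γ.1 0 with hg
    have hgpos : 0 < ‖g‖ := by linarith
    obtain ⟨δ, hδ⟩ := hd ((1 - (d + 1) / ‖g‖) • g)
    have hfrac : (d + 1) / ‖g‖ ≤ 1 := by rw [div_le_one hgpos]; linarith
    have hx : ‖(1 - (d + 1) / ‖g‖) • g‖ = ‖g‖ - (d + 1) := by
      rw [norm_smul, Real.norm_of_nonneg (by linarith)]; field_simp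
    have hgx : ‖g - (1 - (d + 1) / ‖g‖) • g‖ = d + 1 := by
      have : g - (1 - (d + 1) / ‖g‖) • g = ((d + 1) / ‖g‖) • g := by
        rw [sub_smul, one_smul]; abel
      rw [this, norm_smul, Real.norm_of_nonneg (by positivity)]; field_simp
    have h1 : ‖δ.1 0‖ ≤ k := by
      have := norm_sub_norm_le (δ.1 0) ((1 - (d + 1) / ‖g‖) • g)
      push_cast at hγ
      linarith
    have h2 : ‖(δ⁻¹ * γ).1 0‖ ≤ 2 * d + 1 := by
      have e1 : δ.1 ((δ⁻¹ * γ).1 0) = g := by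
        change (δ.1 * (δ.1⁻¹ * γ.1)) 0 = _
        rw [mul_inv_cancel_left]
      have e2 : ‖(δ⁻¹ * γ).1 0‖ = ‖g - δ.1 0‖ := by
        rw [← e1, ← dist_eq_norm, δ.1.dist_eq, dist_zero_right]
      rw [e2]
      have e3 : g - δ.1 0 = (g - (1 - (d + 1) / ‖g‖) • g) -
        (δ.1 0 - (1 - (d + 1) / ‖g‖) • g) := by abel
      rw [e3]
      refine (norm_sub_le _ _).trans ?_
      linarith
    have h3 : γ = δ * (δ⁻¹ * γ) := by group
    rw [h3]
    exact mul_mem (ih δ h1) (Subgroup.subset_closure h2)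

/-- **Bieberbach's first theorem** (in the form needed here). -/
lemma bieberbach [FiniteDimensional ℝ E] (Γ : Subgroup (E ≃ᵢ E))
    (hfin : ∀ R : ℝ, {γ : Γ | ‖γ.1 0‖ ≤ R}.Finite) (d : ℝ)
    (hd : ∀ x : E, ∃ γ : Γ, ‖γ.1 0 - x‖ ≤ d) :
    ∃ N : Subgroup Γ, N.Normal ∧ N.FiniteIndex ∧ ∀ a ∈ N, ∀ b ∈ N, a * b = b * a := by
  let f : Γ →* (E ≃ₗᵢ[ℝ] E) := linPartHom.comp Γ.subtype
  have hf : ∀ γ : Γ, γ ∈ f.ker ↔ ∀ x, linPart γ.1 x = x := by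
    intro γ
    rw [MonoidHom.mem_ker]
    exact ⟨fun h x => DFunLike.congr_fun h x, fun h => LinearIsometryEquiv.ext h⟩
  refine ⟨f.ker, inferInstance, ?_, ?_⟩
  · have : Finite (Set.range f) := by
      by_contra hinf
      rw [not_finite_iff_infinite] at hinf
      let e := Infinite.natEmbedding (Set.range f)
      choose β hβ using fun k => (e k).2
      obtain ⟨φ, hφ, hnear⟩ := subseq_near (fun k => (β k).1) (ε := 1 / 2) (by norm_num)
      have h1 := near_half Γ hfin d hd (β (φ 1) * (β (φ 0))⁻¹) (hnear 0 1)
      rw [← hf, MonoidHom.mem_ker, map_mul, map_inv, mul_inv_eq_one, hβ, hβ] at h1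
      have h2 := hφ.injective (e.injective (Subtype.ext h1))
      omega
    have : Finite f.range := this
    exact Subgroup.finiteIndex_ker f
  · intro a ha b hb
    rw [hf] at ha hb
    apply Subtype.ext
    ext1 x
    change a.1 (b.1 x) = b.1 (a.1 x)
    rw [linPart_add a.1 (b.1 x), linPart_add b.1 x, linPart_add b.1 (a.1 x), linPart_add a.1 x, ha, hb, ha, hb]
    abel

end geo

theorem stmt_13 (n : ℕ)
    (Γ : Subgroup (EuclideanSpace ℝ (Fin n) ≃ᵢ EuclideanSpace ℝ (Fin n)))
    (hdisc : ∀ K : Set (EuclideanSpace ℝ (Fin n)), IsCompact K →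
      {γ : Γ | ((γ : EuclideanSpace ℝ (Fin n) ≃ᵢ EuclideanSpace ℝ (Fin n)) '' K ∩ K).Nonempty}.Finite)
    (hcocpt : ∃ K : Set (EuclideanSpace ℝ (Fin n)), IsCompact K ∧
      (⋃ γ : Γ, (γ : EuclideanSpace ℝ (Fin n) ≃ᵢ EuclideanSpace ℝ (Fin n)) '' K) = Set.univ) :
    (∃ M : ℕ, ∀ g ∈ Subgroup.closure {x : Γ | IsOfFinOrder x}, ∃ l : List Γ,
      (∀ x ∈ l, IsOfFinOrder x) ∧ l.length ≤ M ∧ l.prod = g) ∧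
    ∀ g ∈ Subgroup.closure {x : Γ | IsOfFinOrder x},
      swl {x : Γ | IsOfFinOrder x} g = 0 := by
  have hfin : ∀ R : ℝ, {γ : Γ | ‖γ.1 0‖ ≤ R}.Finite := by
    intro R
    refine (hdisc (Metric.closedBall 0 R) (isCompact_closedBall _ _)).subset fun γ hγ => ?_
    have hR : 0 ≤ R := (norm_nonneg _).trans hγ
    exact ⟨γ.1 0, ⟨0, by simpa using hR, rfl⟩, by simpa using hγ⟩
  obtain ⟨K, hK, hcov⟩ := hcocpt
  obtain ⟨d, hd⟩ := hK.isBounded.exists_norm_le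
  have hd' : ∀ x : EuclideanSpace ℝ (Fin n), ∃ γ : Γ, ‖γ.1 0 - x‖ ≤ d := by
    intro x
    have hx : x ∈ ⋃ γ : Γ,
        (γ : EuclideanSpace ℝ (Fin n) ≃ᵢ EuclideanSpace ℝ (Fin n)) '' K := by
      rw [hcov]; trivial
    obtain ⟨γ, k, hk, rfl⟩ := Set.mem_iUnion.1 hx
    refine ⟨γ, ?_⟩
    rw [← dist_eq_norm, γ.1.dist_eq, dist_zero_left]
    exact hd k hk
  have hfg : Group.FG Γ := group_fg Γ hfin d hd'
  obtain ⟨N, hN1, hN2, hN3⟩ := bieberbach Γ hfin d hd'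
  obtain ⟨M, hM⟩ := bounded_closure N hN3
  refine ⟨⟨M, hM⟩, fun g hg => ?_⟩
  have hwl : ∀ k : ℕ, wl {x : Γ | IsOfFinOrder x} (g ^ k) ≤ M := by
    intro k
    obtain ⟨l, h1, h2, h3⟩ := hM _ (pow_mem hg k)
    unfold wl
    refine le_trans (Nat.sInf_le (m := l.length) ?_) h2
    exact ⟨l, h1, rfl, h3⟩
  have hbdd : BddBelow (Set.range fun n : ℕ+ =>
      (wl {x : Γ | IsOfFinOrder x} (g ^ (n : ℕ)) : ℝ) / (n : ℕ)) :=
    ⟨0, by rintro _ ⟨k, rfl⟩; positivity⟩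
  refine le_antisymm (le_of_forall_pos_le_add fun ε hε => ?_)
    (Real.iInf_nonneg fun k => by positivity)
  obtain ⟨k, hk⟩ := exists_nat_ge ((M : ℝ) / ε)
  refine (ciInf_le hbdd k.succPNat).trans ?_
  have h1 : (wl {x : Γ | IsOfFinOrder x} (g ^ (k.succPNat : ℕ)) : ℝ) ≤ M := by
    exact_mod_cast hwl _
  have h2 : (0 : ℝ) < ((k.succPNat : ℕ) : ℝ) := by positivity
  rw [zero_add, div_le_iff₀ h2]
  rw [div_le_iff₀ hε] at hk
  have h3 : ((k.succPNat : ℕ) : ℝ) = k + 1 := by simp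
  rw [h3]
  nlinarith
end

section
/- In the (p,q,r)-triangle group Γ = ⟨a,b,c | a² = b² = c² = (ab)^p = (bc)^q = (ac)^r = 1⟩ with 1/p + 1/q + 1/r ≥ 1, the stable torsion length of every element is zero. -/
/-- Relators of the (p,q,r)-triangle group
`⟨a,b,c | a² = b² = c² = (ab)^p = (bc)^q = (ac)^r = 1⟩`. -/
def triRels (p q r : ℕ) : Set (FreeGroup (Fin 3)) :=
  {FreeGroup.of 0 ^ 2, FreeGroup.of 1 ^ 2, FreeGroup.of 2 ^ 2,
   (FreeGroup.of 0 * FreeGroup.of 1) ^ p,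
   (FreeGroup.of 1 * FreeGroup.of 2) ^ q,
   (FreeGroup.of 0 * FreeGroup.of 2) ^ r}

set_option linter.unusedSimpArgs false

/-- Some arbitrarily large powers of `g` are products of boundedly many torsion elements. -/
def TorBdd {G : Type*} [Group G] (g : G) : Prop :=
  ∃ C : ℕ, ∀ N : ℕ, ∃ n : ℕ, N < n ∧ ∃ l : List G,
    (∀ x ∈ l, IsOfFinOrder x) ∧ l.length ≤ C ∧ l.prod = g ^ n

/-- `a`, `b`, `c` generate `G` and satisfy the triangle group relations. -/
structure Tri {G : Type*} [Group G] (a b c : G) (p q r : ℕ) : Prop where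
  a2 : a * a = 1
  b2 : b * b = 1
  c2 : c * c = 1
  ab : (a * b) ^ p = 1
  bc : (b * c) ^ q = 1
  ac : (a * c) ^ r = 1
  gen : Subgroup.closure {a, b, c} = (⊤ : Subgroup G)

theorem swl_zero_of_torBdd {G : Type*} [Group G] (g : G) (hg : TorBdd g) :
    swl {x : G | IsOfFinOrder x} g = 0 := by
  obtain ⟨C, hC⟩ := hg
  have hbdd : BddBelow (Set.range fun n : ℕ+ =>
      (wl {x : G | IsOfFinOrder x} (g ^ (n : ℕ)) : ℝ) / (n : ℕ)) :=
    ⟨0, by rintro _ ⟨n, rfl⟩; positivity⟩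
  apply le_antisymm
  · refine le_of_forall_pos_le_add fun ε hε => ?_
    obtain ⟨N, hN⟩ := exists_nat_gt ((C : ℝ) / ε)
    obtain ⟨n, hn, l, hl, hlen, hprod⟩ := hC N
    have hn0 : 0 < n := by omega
    refine (ciInf_le hbdd ⟨n, hn0⟩).trans ?_
    have h1 : wl {x : G | IsOfFinOrder x} (g ^ n) ≤ C :=
      (Nat.sInf_le (show l.length ∈ {k | ∃ l : List G, (∀ x ∈ l, x ∈ {x : G | IsOfFinOrder x}) ∧
        l.length = k ∧ l.prod = g ^ n} from ⟨l, hl, rfl, hprod⟩)).trans hlen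
    have h2 : (wl {x : G | IsOfFinOrder x} (g ^ n) : ℝ) ≤ C := by exact_mod_cast h1
    have h3 : (N : ℝ) < n := by exact_mod_cast hn
    have h4 : (0 : ℝ) < n := by exact_mod_cast hn0
    simp only [PNat.mk_coe, zero_add]
    rw [div_le_iff₀ h4]
    rw [div_lt_iff₀ hε] at hN
    nlinarith
  · exact Real.iInf_nonneg fun n => by positivity

theorem torBdd_of_finOrder {G : Type*} [Group G] (g : G) (hg : IsOfFinOrder g) : TorBdd g := by
  obtain ⟨m, hm, h1⟩ := isOfFinOrder_iff_pow_eq_one.1 hg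
  refine ⟨0, fun N => ⟨m * (N + 1), by nlinarith, [], by simp, by simp, ?_⟩⟩
  rw [pow_mul, h1]; simp

theorem involution_finOrder {G : Type*} [Group G] {g : G} (hg : g * g = 1) : IsOfFinOrder g :=
  isOfFinOrder_iff_pow_eq_one.2 ⟨2, by norm_num, by rw [pow_two, hg]⟩

theorem inverted_zpow {G : Type*} [Group G] {s t : G} (hs : s * s = 1) (h : s * t * s = t⁻¹)
    (k : ℤ) : ∃ x y : G, IsOfFinOrder x ∧ IsOfFinOrder y ∧ t ^ k = x * y := by
  have hi : s⁻¹ = s := inv_eq_of_mul_eq_one_left hs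
  refine ⟨s, s * t ^ k, involution_finOrder hs, involution_finOrder ?_, ?_⟩
  · have : s * t ^ k * s⁻¹ = (t ^ k)⁻¹ := by
      rw [← conj_zpow, hi, h, inv_zpow]
    rw [hi] at this
    calc s * t ^ k * (s * t ^ k) = (s * t ^ k * s) * t ^ k := by group
      _ = 1 := by rw [this]; group
  · rw [← mul_assoc, hs, one_mul]

theorem mem_closure_three {G : Type*} [Group G] {t u v : G} (htu : t * u = u * t)
    (htv : t * v = v * t) (huv : u * v = v * u) {g : G}
    (hg : g ∈ Subgroup.closure {t, u, v}) : ∃ i j k : ℤ, g = t ^ i * u ^ j * v ^ k := by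
  have c1 : ∀ i j : ℤ, Commute (t ^ i) (u ^ j) := fun i j =>
    ((show Commute t u from htu).zpow_left i).zpow_right j
  have c2 : ∀ i j : ℤ, Commute (t ^ i) (v ^ j) := fun i j =>
    ((show Commute t v from htv).zpow_left i).zpow_right j
  have c3 : ∀ i j : ℤ, Commute (u ^ i) (v ^ j) := fun i j =>
    ((show Commute u v from huv).zpow_left i).zpow_right j
  induction hg using Subgroup.closure_induction with
  | mem x hx =>
    rcases hx with rfl | rfl | rfl
    · exact ⟨1, 0, 0, by simp⟩
    · exact ⟨0, 1, 0, by simp⟩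
    · exact ⟨0, 0, 1, by simp⟩
  | one => exact ⟨0, 0, 0, by simp⟩
  | mul x y _ _ hx hy =>
    obtain ⟨i, j, k, rfl⟩ := hx
    obtain ⟨i', j', k', rfl⟩ := hy
    refine ⟨i + i', j + j', k + k', ?_⟩
    rw [zpow_add, zpow_add, zpow_add]
    calc t ^ i * u ^ j * v ^ k * (t ^ i' * u ^ j' * v ^ k')
        = t ^ i * u ^ j * (v ^ k * t ^ i') * u ^ j' * v ^ k' := by simp only [mul_assoc]
      _ = t ^ i * (u ^ j * t ^ i') * (v ^ k * u ^ j') * v ^ k' := by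
          rw [← (c2 i' k).eq]; simp only [mul_assoc]
      _ = t ^ i * t ^ i' * (u ^ j * u ^ j') * (v ^ k * v ^ k') := by
          rw [← (c1 i' j).eq, ← (c3 j' k).eq]; simp only [mul_assoc]
  | inv x _ hx =>
    obtain ⟨i, j, k, rfl⟩ := hx
    refine ⟨-i, -j, -k, ?_⟩
    rw [mul_inv_rev, mul_inv_rev, ← zpow_neg, ← zpow_neg, ← zpow_neg, ← (c1 (-i) (-j)).eq,
      ← ((c2 (-i) (-k)).mul_left (c3 (-j) (-k))).eq]

theorem dihedral_finite {Q : Type*} [Group Q] (a b : Q) (p : ℕ) (hp : 0 < p) (a2 : a * a = 1)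
    (b2 : b * b = 1) (ab : (a * b) ^ p = 1) (gen : Subgroup.closure {a, b} = (⊤ : Subgroup Q)) :
    Finite Q := by
  have ai : a⁻¹ = a := inv_eq_of_mul_eq_one_left a2
  have bi : b⁻¹ = b := inv_eq_of_mul_eq_one_left b2
  have hfin : IsOfFinOrder (a * b) := isOfFinOrder_iff_pow_eq_one.2 ⟨p, hp, ab⟩
  have hz : (Subgroup.zpowers (a * b) : Set Q).Finite :=
    finite_zpowers.2 hfin
  have key : ∀ g : Q, ∃ z ∈ Subgroup.zpowers (a * b), g = z ∨ g = a * z := by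
    intro g
    have hg : g ∈ Subgroup.closure {a, b} := by rw [gen]; trivial
    have step : ∀ x ∈ ({a, b} : Set Q), ∀ y,
        (∃ z ∈ Subgroup.zpowers (a * b), y = z ∨ y = a * z) →
        ∃ z ∈ Subgroup.zpowers (a * b), x * y = z ∨ x * y = a * z := by
      rintro x (rfl | rfl) y ⟨z, hz, e | e⟩ <;> subst y
      · exact ⟨z, hz, Or.inr rfl⟩
      · exact ⟨z, hz, Or.inl (by rw [← mul_assoc, a2, one_mul])⟩
      · exact ⟨(a * x) * z, mul_mem (Subgroup.mem_zpowers _) hz, Or.inr (by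
          rw [← mul_assoc, ← mul_assoc, a2, one_mul])⟩
      · refine ⟨(a * x)⁻¹ * z, mul_mem (inv_mem (Subgroup.mem_zpowers _)) hz, Or.inl ?_⟩
        rw [mul_inv_rev, ai, bi, mul_assoc]
    induction hg using Subgroup.closure_induction_left with
    | one => exact ⟨1, one_mem _, Or.inl rfl⟩
    | mul_left x hx y _ ih => exact step x hx y ih
    | inv_mul_cancel x hx y _ ih =>
      have : x⁻¹ = x := by rcases hx with rfl | rfl <;> assumption
      rw [this]; exact step x hx y ih
  have : (Set.univ : Set Q).Finite := by
    refine (hz.union (hz.image (fun z => a * z))).subset fun g _ => ?_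
    obtain ⟨z, hz, rfl | rfl⟩ := key g
    · exact Or.inl hz
    · exact Or.inr ⟨z, hz, rfl⟩
  exact Set.finite_univ_iff.1 this

/-- The criterion: an abelian normal subgroup generated by elements inverted by involutions. -/
theorem torBdd_of_translations {G : Type*} [Group G] {a b c : G} {p q r : ℕ} (hp : 0 < p)
    (T : Tri a b c p q r) (t u v s s' s'' h : G)
    (htu : t * u = u * t) (htv : t * v = v * t) (huv : u * v = v * u)
    (hs : s * s = 1) (hs' : s' * s' = 1) (hs'' : s'' * s'' = 1)
    (hst : s * t * s = t⁻¹) (hsu : s' * u * s' = u⁻¹) (hsv : s'' * v * s'' = v⁻¹)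
    (hat : a * t * a ∈ Subgroup.closure {t, u, v}) (hau : a * u * a ∈ Subgroup.closure {t, u, v})
    (hav : a * v * a ∈ Subgroup.closure {t, u, v}) (hbt : b * t * b ∈ Subgroup.closure {t, u, v})
    (hbu : b * u * b ∈ Subgroup.closure {t, u, v}) (hbv : b * v * b ∈ Subgroup.closure {t, u, v})
    (hh : h ∈ Subgroup.closure {a, b}) (hc : c = t * h) (g : G) : TorBdd g := by
  set N := Subgroup.closure {t, u, v} with hN
  have ht : t ∈ N := Subgroup.subset_closure (by simp)
  have norm_of : ∀ x : G, x * x = 1 → x * t * x ∈ N → x * u * x ∈ N → x * v * x ∈ N →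
      x ∈ Subgroup.normalizer (N : Set G) := by
    intro x x2 h1 h2 h3
    have xi : x⁻¹ = x := inv_eq_of_mul_eq_one_left x2
    have fwd : ∀ y ∈ N, x * y * x⁻¹ ∈ N := by
      intro y hy
      have : N ≤ N.comap (MulAut.conj x).toMonoidHom := by
        rw [hN, Subgroup.closure_le, ← hN]
        rintro z (rfl | rfl | rfl) <;> simpa [xi]
      simpa using this hy
    rw [Subgroup.mem_normalizer_iff]
    intro y
    refine ⟨fwd y, fun hy => ?_⟩
    have := fwd _ hy
    rw [xi] at this
    have e : x * (x * y * x) * x = (x * x) * y * (x * x) := by group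
    rw [e, x2] at this
    simpa using this
  have na := norm_of a T.a2 hat hau hav
  have nb := norm_of b T.b2 hbt hbu hbv
  have nh : h ∈ Subgroup.normalizer (N : Set G) := by
    refine (Subgroup.closure_le _).2 ?_ hh
    rintro z (rfl | rfl) <;> assumption
  have nc : c ∈ Subgroup.normalizer (N : Set G) := by
    rw [hc]; exact mul_mem (Subgroup.le_normalizer ht) nh
  have hnorm : N.Normal := by
    rw [← Subgroup.normalizer_eq_top_iff, eq_top_iff, ← T.gen, Subgroup.closure_le]
    rintro z (rfl | rfl | rfl) <;> assumption
  have hQ : Finite (G ⧸ N) := by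
    refine dihedral_finite (a : G ⧸ N) (b : G ⧸ N) p hp ?_ ?_ ?_ ?_
    · rw [← QuotientGroup.mk_mul, T.a2]; rfl
    · rw [← QuotientGroup.mk_mul, T.b2]; rfl
    · rw [← QuotientGroup.mk_mul, ← QuotientGroup.mk_pow, T.ab]; rfl
    · rw [eq_top_iff]
      have hmap : (⊤ : Subgroup G) ≤
          (Subgroup.closure {(a : G ⧸ N), (b : G ⧸ N)}).comap (QuotientGroup.mk' N) := by
        have h1 : a ∈ (Subgroup.closure {(a : G ⧸ N), (b : G ⧸ N)}).comap
            (QuotientGroup.mk' N) := Subgroup.subset_closure (by simp)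
        have h2 : b ∈ (Subgroup.closure {(a : G ⧸ N), (b : G ⧸ N)}).comap
            (QuotientGroup.mk' N) := Subgroup.subset_closure (by simp)
        rw [← T.gen, Subgroup.closure_le]
        rintro z (rfl | rfl | rfl)
        · exact h1
        · exact h2
        · rw [hc]
          refine mul_mem ?_ ?_
          · have : (QuotientGroup.mk' N) t = 1 := (QuotientGroup.eq_one_iff t).2 ht
            rw [Subgroup.mem_comap, this]; exact one_mem _
          · refine (Subgroup.closure_le _).2 ?_ hh
            rintro z (rfl | rfl) <;> assumption
      intro x _
      obtain ⟨y, rfl⟩ := QuotientGroup.mk'_surjective N x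
      exact hmap (Subgroup.mem_top y)
  have hpow : ∃ m : ℕ, 0 < m ∧ g ^ m ∈ N := by
    obtain ⟨m, hm, h1⟩ := isOfFinOrder_iff_pow_eq_one.1 (isOfFinOrder_of_finite (g : G ⧸ N))
    refine ⟨m, hm, ?_⟩
    rw [← QuotientGroup.eq_one_iff, QuotientGroup.mk_pow, h1]
  obtain ⟨m, hm, hgm⟩ := hpow
  refine ⟨6, fun M => ⟨m * (M + 1), by nlinarith, ?_⟩⟩
  have hmem : g ^ (m * (M + 1)) ∈ N := by rw [pow_mul]; exact pow_mem hgm _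
  obtain ⟨i, j, k, he⟩ := mem_closure_three htu htv huv hmem
  obtain ⟨x1, y1, hx1, hy1, e1⟩ := inverted_zpow hs hst i
  obtain ⟨x2, y2, hx2, hy2, e2⟩ := inverted_zpow hs' hsu j
  obtain ⟨x3, y3, hx3, hy3, e3⟩ := inverted_zpow hs'' hsv k
  refine ⟨[x1, y1, x2, y2, x3, y3], by simp [*], by simp, ?_⟩
  rw [he, e1, e2, e3]; simp [mul_assoc]

namespace Tri
variable {G : Type*} [Group G] {a b c : G} {p q r : ℕ}

theorem swap_pow_one {x y : G} {n : ℕ} (hx : x * x = 1) (hy : y * y = 1)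
    (h : (x * y) ^ n = 1) : (y * x) ^ n = 1 := by
  have : y * x = (x * y)⁻¹ := by
    rw [mul_inv_rev, inv_eq_of_mul_eq_one_left hx, inv_eq_of_mul_eq_one_left hy]
  rw [this, inv_pow, h, inv_one]

theorem swap_ab (T : Tri a b c p q r) : Tri b a c p r q :=
  ⟨T.b2, T.a2, T.c2, swap_pow_one T.a2 T.b2 T.ab, T.ac, T.bc, by
    rw [Set.insert_comm]; exact T.gen⟩

theorem swap_bc (T : Tri a b c p q r) : Tri a c b r q p :=
  ⟨T.a2, T.c2, T.b2, T.ac, swap_pow_one T.b2 T.c2 T.bc, T.ab, by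
    rw [Set.pair_comm]; exact T.gen⟩

theorem swap_ac (T : Tri a b c p q r) : Tri c b a q p r := T.swap_ab.swap_bc.swap_ab

theorem cancel {x : G} (h : x * x = 1) (y : G) : x * (x * y) = y := by
  rw [← mul_assoc, h, one_mul]

/-- From an equation between words obtain the version with a tail. -/
theorem comm_of_two {x y : G} (hx : x * x = 1) (hy : y * y = 1) (h : (x * y) ^ 2 = 1) :
    x * y = y * x := by
  have h2 := swap_pow_one hx hy h
  have : x * y = (x * y)⁻¹ := by
    rw [eq_inv_iff_mul_eq_one, ← pow_two, h]
  rw [this, mul_inv_rev, inv_eq_of_mul_eq_one_left hx, inv_eq_of_mul_eq_one_left hy]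

theorem braid3 {x y : G} (hx : x * x = 1) (hy : y * y = 1) (h : (x * y) ^ 3 = 1) :
    x * (y * x) = y * (x * y) := by
  have h1 : x * (y * x) * (y * (x * y)) = 1 := by
    rw [← h]; simp only [pow_succ, pow_zero, one_mul, mul_assoc]
  rw [eq_inv_of_mul_eq_one_left h1]
  simp only [mul_inv_rev, inv_eq_of_mul_eq_one_left hx, inv_eq_of_mul_eq_one_left hy, mul_assoc]

theorem braid4 {x y : G} (hx : x * x = 1) (hy : y * y = 1) (h : (x * y) ^ 4 = 1) :
    x * (y * (x * y)) = y * (x * (y * x)) := by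
  have h1 : x * (y * (x * y)) * (x * (y * (x * y))) = 1 := by
    rw [← h]; simp only [pow_succ, pow_zero, one_mul, mul_assoc]
  nth_rewrite 1 [eq_inv_of_mul_eq_one_left h1]
  simp only [mul_inv_rev, inv_eq_of_mul_eq_one_left hx, inv_eq_of_mul_eq_one_left hy, mul_assoc]

theorem braid5 {x y : G} (hx : x * x = 1) (hy : y * y = 1) (h : (x * y) ^ 5 = 1) :
    x * (y * (x * (y * x))) = y * (x * (y * (x * y))) := by
  have h1 : x * (y * (x * (y * x))) * (y * (x * (y * (x * y)))) = 1 := by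
    rw [← h]; simp only [pow_succ, pow_zero, one_mul, mul_assoc]
  rw [eq_inv_of_mul_eq_one_left h1]
  simp only [mul_inv_rev, inv_eq_of_mul_eq_one_left hx, inv_eq_of_mul_eq_one_left hy, mul_assoc]

theorem braid6 {x y : G} (hx : x * x = 1) (hy : y * y = 1) (h : (x * y) ^ 6 = 1) :
    x * (y * (x * (y * (x * y)))) = y * (x * (y * (x * (y * x)))) := by
  have h1 : x * (y * (x * (y * (x * y)))) * (x * (y * (x * (y * (x * y))))) = 1 := by
    rw [← h]; simp only [pow_succ, pow_zero, one_mul, mul_assoc]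
  nth_rewrite 1 [eq_inv_of_mul_eq_one_left h1]
  simp only [mul_inv_rev, inv_eq_of_mul_eq_one_left hx, inv_eq_of_mul_eq_one_left hy, mul_assoc]

theorem tail2 {x y z w : G} (h : x * y = z * w) (u : G) : x * (y * u) = z * (w * u) := by
  rw [← mul_assoc, h, mul_assoc]

theorem tail3 {x y z x' y' z' : G} (h : x * (y * z) = x' * (y' * z')) (u : G) :
    x * (y * (z * u)) = x' * (y' * (z' * u)) := by
  simpa only [mul_assoc] using congrArg (· * u) h

theorem tail4 {x y z w x' y' z' w' : G} (h : x * (y * (z * w)) = x' * (y' * (z' * w'))) (u : G) :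
    x * (y * (z * (w * u))) = x' * (y' * (z' * (w' * u))) := by
  simpa only [mul_assoc] using congrArg (· * u) h

theorem tail5 {x y z w v x' y' z' w' v' : G}
    (h : x * (y * (z * (w * v))) = x' * (y' * (z' * (w' * v')))) (u : G) :
    x * (y * (z * (w * (v * u)))) = x' * (y' * (z' * (w' * (v' * u)))) := by
  simpa only [mul_assoc] using congrArg (· * u) h

theorem tail6 {x y z w v m x' y' z' w' v' m' : G}
    (h : x * (y * (z * (w * (v * m)))) = x' * (y' * (z' * (w' * (v' * m'))))) (u : G) :
    x * (y * (z * (w * (v * (m * u))))) = x' * (y' * (z' * (w' * (v' * (m' * u))))) := by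
  simpa only [mul_assoc] using congrArg (· * u) h

theorem case22 (T : Tri a b c p 2 2) (hp : 0 < p) (g : G) : TorBdd g := by
  have e1 := comm_of_two T.b2 T.c2 T.bc
  have e2 := comm_of_two T.a2 T.c2 T.ac
  have hc : c ∈ Subgroup.closure {c, c, c} := Subgroup.subset_closure (by simp)
  have ha : a * c * a = c := by rw [e2, mul_assoc, T.a2, mul_one]
  have hb : b * c * b = c := by rw [e1, mul_assoc, T.b2, mul_one]
  have hi : 1 * c * 1 = c⁻¹ := by rw [inv_eq_of_mul_eq_one_left T.c2]; simp
  refine torBdd_of_translations hp T c c c 1 1 1 1 rfl rfl rfl (by simp) (by simp) (by simp)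
    hi hi hi ?_ ?_ ?_ ?_ ?_ ?_ (one_mem _) (by simp) g <;> simpa only [ha, hb] using hc

/-- Two-generator version of the criterion. -/
theorem two_translations (T : Tri a b c p q r) (hp : 0 < p) (t u s s' h : G)
    (htu : t * u = u * t) (hs : s * s = 1) (hs' : s' * s' = 1)
    (hst : s * t * s = t⁻¹) (hsu : s' * u * s' = u⁻¹)
    (hat : a * t * a ∈ Subgroup.closure {t, u, 1}) (hau : a * u * a ∈ Subgroup.closure {t, u, 1})
    (hbt : b * t * b ∈ Subgroup.closure {t, u, 1}) (hbu : b * u * b ∈ Subgroup.closure {t, u, 1})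
    (hh : h ∈ Subgroup.closure {a, b}) (hc : c = t * h) (g : G) : TorBdd g :=
  torBdd_of_translations hp T t u 1 s s' 1 h htu (by simp) (by simp) hs hs' (by simp) hst hsu
    (by simp) hat hau (by simpa only [mul_one, T.a2] using one_mem _) hbt hbu
    (by simpa only [mul_one, T.b2] using one_mem _) hh hc g

theorem case333 (T : Tri a b c 3 3 3) (g : G) : TorBdd g := by
  have ai := inv_eq_of_mul_eq_one_left T.a2
  have bi := inv_eq_of_mul_eq_one_left T.b2
  have ci := inv_eq_of_mul_eq_one_left T.c2
  have A := cancel T.a2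
  have B := cancel T.b2
  have C := cancel T.c2
  have a2 := T.a2
  have b2 := T.b2
  have c2 := T.c2
  have k1 := braid3 T.b2 T.a2 (swap_pow_one T.a2 T.b2 T.ab)
  have k2 := braid3 T.c2 T.b2 (swap_pow_one T.b2 T.c2 T.bc)
  have k3 := braid3 T.c2 T.a2 (swap_pow_one T.a2 T.c2 T.ac)
  have k1' := tail3 k1
  have k2' := tail3 k2
  have k3' := tail3 k3
  have ma : a ∈ Subgroup.closure {a, b} := Subgroup.subset_closure (by simp)
  have mb : b ∈ Subgroup.closure {a, b} := Subgroup.subset_closure (by simp)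
  set t := c * (a * (b * a)) with ht
  set u := a * (c * (a * b)) with hu
  have mt : t ∈ Subgroup.closure {t, u, 1} := Subgroup.subset_closure (by simp)
  have mu : u ∈ Subgroup.closure {t, u, 1} := Subgroup.subset_closure (by simp)
  have f1 : b * t * b = t * u⁻¹ := by
    simp only [ht, hu, mul_inv_rev, ai, bi, ci, mul_assoc, A, B, C, a2, b2, c2, mul_one, k1, k1',
      k2, k2', k3, k3']
  have f2 : b * t * b = u⁻¹ * t := by
    simp only [ht, hu, mul_inv_rev, ai, bi, ci, mul_assoc, A, B, C, a2, b2, c2, mul_one, k1, k1',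
      k2, k2', k3, k3']
  have hb : b * u * b = u⁻¹ := by
    simp only [hu, mul_inv_rev, ai, bi, ci, mul_assoc, A, B, C, a2, b2, c2, mul_one]
  have htu : t * u = u * t := by
    have : t * u⁻¹ = u⁻¹ * t := f1 ▸ f2
    have h3 : Commute t u⁻¹ := this
    exact (Commute.inv_right_iff.1 h3).eq
  refine two_translations T (by norm_num) t u (a * (b * a)) b (a * (b * a)) htu ?_ b2 ?_ hb
    ?_ ?_ ?_ ?_ (mul_mem ma (mul_mem mb ma)) ?_ g
  · simp only [mul_assoc, A, B, a2]
  · simp only [ht, mul_inv_rev, ai, bi, ci, mul_assoc, A, B, C, a2, b2, c2, mul_one]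
  · have : a * t * a = u := by simp only [ht, hu, mul_assoc, a2, mul_one]
    rw [this]; exact mu
  · have : a * u * a = t := by simp only [ht, hu, mul_assoc, A]
    rw [this]; exact mt
  · rw [f1]; exact mul_mem mt (inv_mem mu)
  · rw [hb]; exact inv_mem mu
  · simp only [ht, mul_assoc, A, B, a2, mul_one]

theorem case442 (T : Tri a b c 4 4 2) (g : G) : TorBdd g := by
  have ai := inv_eq_of_mul_eq_one_left T.a2
  have bi := inv_eq_of_mul_eq_one_left T.b2
  have ci := inv_eq_of_mul_eq_one_left T.c2
  have A := cancel T.a2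
  have B := cancel T.b2
  have C := cancel T.c2
  have a2 := T.a2
  have b2 := T.b2
  have c2 := T.c2
  have k1 := braid4 T.b2 T.a2 (swap_pow_one T.a2 T.b2 T.ab)
  have k2 := braid4 T.c2 T.b2 (swap_pow_one T.b2 T.c2 T.bc)
  have k3 := comm_of_two T.c2 T.a2 (swap_pow_one T.a2 T.c2 T.ac)
  have k1' := tail4 k1
  have k2' := tail4 k2
  have k3' := tail2 k3
  have ma : a ∈ Subgroup.closure {a, b} := Subgroup.subset_closure (by simp)
  have mb : b ∈ Subgroup.closure {a, b} := Subgroup.subset_closure (by simp)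
  set t := c * (b * (a * b)) with ht
  set u := b * (c * (b * a)) with hu
  have mt : t ∈ Subgroup.closure {t, u, 1} := Subgroup.subset_closure (by simp)
  have mu : u ∈ Subgroup.closure {t, u, 1} := Subgroup.subset_closure (by simp)
  have htu : t * u = u * t := by
    calc t * u = c * (b * ((a * c) * (b * a))) := by
          simp only [ht, hu, mul_assoc, B]
      _ = (c * (b * (c * b))) * (b * (a * (b * a))) := by
          rw [← k3]; simp only [mul_assoc, B]
      _ = (b * (c * (b * c))) * (a * (b * (a * b))) := by rw [k1, k2]
      _ = u * t := by simp only [ht, hu, mul_assoc, k3']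
  refine two_translations T (by norm_num) t u (b * (a * b)) a (b * (a * b)) htu ?_ a2 ?_ ?_
    ?_ ?_ ?_ ?_ (mul_mem mb (mul_mem ma mb)) ?_ g
  · simp only [mul_assoc, A, B, b2]
  · simp only [ht, mul_inv_rev, ai, bi, ci, mul_assoc, A, B, C, a2, b2, c2, mul_one]
  · simp only [hu, mul_inv_rev, ai, bi, ci, mul_assoc, A, B, C, a2, b2, c2, mul_one]
  · have : a * t * a = t := by
      simp only [ht, mul_assoc, k1, k3', A]
    rw [this]; exact mt
  · have : a * u * a = u⁻¹ := by
      simp only [hu, mul_inv_rev, ai, bi, ci, mul_assoc, a2, mul_one]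
    rw [this]; exact inv_mem mu
  · have : b * t * b = u := by simp only [ht, hu, mul_assoc, b2, mul_one]
    rw [this]; exact mu
  · have : b * u * b = t := by simp only [ht, hu, mul_assoc, B]
    rw [this]; exact mt
  · simp only [ht, mul_assoc, A, B, b2, mul_one]

theorem case632 (T : Tri a b c 6 3 2) (g : G) : TorBdd g := by
  have ai := inv_eq_of_mul_eq_one_left T.a2
  have bi := inv_eq_of_mul_eq_one_left T.b2
  have ci := inv_eq_of_mul_eq_one_left T.c2
  have A := cancel T.a2
  have B := cancel T.b2
  have C := cancel T.c2
  have a2 := T.a2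
  have b2 := T.b2
  have c2 := T.c2
  have k1 := braid6 T.b2 T.a2 (swap_pow_one T.a2 T.b2 T.ab)
  have k2 := braid3 T.c2 T.b2 (swap_pow_one T.b2 T.c2 T.bc)
  have k3 := comm_of_two T.c2 T.a2 (swap_pow_one T.a2 T.c2 T.ac)
  have k1' := tail6 k1
  have k2' := tail3 k2
  have k3' := tail2 k3
  have ma : a ∈ Subgroup.closure {a, b} := Subgroup.subset_closure (by simp)
  have mb : b ∈ Subgroup.closure {a, b} := Subgroup.subset_closure (by simp)
  set t := c * (b * (a * (b * (a * b)))) with ht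
  set u := b * (c * (b * (a * (b * a)))) with hu
  have mt : t ∈ Subgroup.closure {t, u, 1} := Subgroup.subset_closure (by simp)
  have mu : u ∈ Subgroup.closure {t, u, 1} := Subgroup.subset_closure (by simp)
  have hat : a * t * a = t := by
    simp only [ht, mul_assoc, k1, k3', A]
  have f1 : (a * u * a) * u = t := by
    calc (a * u * a) * u = a * (b * (c * (b * ((a * c) * (b * (a * (b * a))))))) := by
          simp only [hu, mul_assoc, B, A]
      _ = a * (b * ((c * (b * c)) * (a * (b * (a * (b * a)))))) := by
          rw [← k3]; simp only [mul_assoc]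
      _ = (a * c) * (b * (a * (b * (a * (b * a))))) := by
          rw [k2]; simp only [mul_assoc, B]
      _ = t := by rw [k1, ← k3]; simp only [ht, mul_assoc, A]
  have f2 : u * (a * u * a) = t := by
    calc u * (a * u * a) = a * ((a * u * a) * u) * a := by simp only [mul_assoc, A, a2, mul_one]
      _ = t := by rw [f1, hat]
  have f3 : a * u * a = t * u⁻¹ := by rw [← f1]; group
  have htu : t * u = u * t := by
    calc t * u = u * (a * u * a) * u := by rw [f2]
      _ = u * ((a * u * a) * u) := by simp only [mul_assoc]
      _ = u * t := by rw [f1]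
  refine two_translations T (by norm_num) t u (b * (a * (b * (a * b)))) (a * (b * a))
    (b * (a * (b * (a * b)))) htu ?_ ?_ ?_ ?_
    ?_ ?_ ?_ ?_ (mul_mem mb (mul_mem ma (mul_mem mb (mul_mem ma mb)))) ?_ g
  · simp only [mul_assoc, A, B, b2]
  · simp only [mul_assoc, A, B, a2]
  · simp only [ht, mul_inv_rev, ai, bi, ci, mul_assoc, A, B, C, a2, b2, c2, mul_one]
  · simp only [hu, mul_inv_rev, ai, bi, ci, mul_assoc, A, B, C, a2, b2, c2, mul_one]
  · rw [hat]; exact mt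
  · rw [f3]; exact mul_mem mt (inv_mem mu)
  · have : b * t * b = u := by simp only [ht, hu, mul_assoc, b2, mul_one]
    rw [this]; exact mu
  · have : b * u * b = t := by simp only [ht, hu, mul_assoc, B]
    rw [this]; exact mt
  · simp only [ht, mul_assoc, A, B, b2, mul_one]

theorem case332 (T : Tri a b c 3 3 2) (g : G) : TorBdd g := by
  have ai := inv_eq_of_mul_eq_one_left T.a2
  have bi := inv_eq_of_mul_eq_one_left T.b2
  have ci := inv_eq_of_mul_eq_one_left T.c2
  have A := cancel T.a2
  have B := cancel T.b2
  have C := cancel T.c2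
  have a2 := T.a2
  have b2 := T.b2
  have c2 := T.c2
  have k1 := braid3 T.b2 T.a2 (swap_pow_one T.a2 T.b2 T.ab)
  have k2 := braid3 T.c2 T.b2 (swap_pow_one T.b2 T.c2 T.bc)
  have k3 := comm_of_two T.c2 T.a2 (swap_pow_one T.a2 T.c2 T.ac)
  have k3' := tail2 k3
  have ma : a ∈ Subgroup.closure {a, b} := Subgroup.subset_closure (by simp)
  set t := c * a with ht
  set u := b * (c * (a * b)) with hu
  have mt : t ∈ Subgroup.closure {t, u, 1} := Subgroup.subset_closure (by simp)
  have mu : u ∈ Subgroup.closure {t, u, 1} := Subgroup.subset_closure (by simp)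
  have ti : t⁻¹ = t := by simp only [ht, mul_inv_rev, ai, ci]; exact k3.symm
  have ui : u⁻¹ = u := by simp only [hu, mul_inv_rev, ai, bi, ci, mul_assoc, k3']
  have f1 : a * u * a = t * u := by
    calc a * u * a = a * (b * (c * (a * (b * a)))) := by simp only [hu, mul_assoc]
      _ = a * ((b * (c * b)) * (a * b)) := by rw [← k1]; simp only [mul_assoc]
      _ = t * u := by rw [← k2]; simp only [ht, hu, mul_assoc, k3']
  have f2 : (a * u * a)⁻¹ = a * u * a := by
    simp only [mul_inv_rev, ai, ui, mul_assoc]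
  have htu : t * u = u * t := by
    rw [f1, mul_inv_rev, ti, ui] at f2
    exact f2.symm
  refine two_translations T (by norm_num) t u 1 1 a htu (by simp) (by simp) (by simp [ti])
    (by simp [ui]) ?_ ?_ ?_ ?_ ma ?_ g
  · have : a * t * a = t := by simp only [ht, mul_assoc, a2, mul_one]; exact k3.symm
    rw [this]; exact mt
  · rw [f1]; exact mul_mem mt mu
  · have : b * t * b = u := by simp only [ht, hu, mul_assoc]
    rw [this]; exact mu
  · have : b * u * b = t := by simp only [ht, hu, mul_assoc, B, b2, mul_one]
    rw [this]; exact mt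
  · simp only [ht, mul_assoc, a2, mul_one]

theorem case342 (T : Tri a b c 3 4 2) (g : G) : TorBdd g := by
  have ai := inv_eq_of_mul_eq_one_left T.a2
  have bi := inv_eq_of_mul_eq_one_left T.b2
  have ci := inv_eq_of_mul_eq_one_left T.c2
  have A := cancel T.a2
  have B := cancel T.b2
  have C := cancel T.c2
  have a2 := T.a2
  have b2 := T.b2
  have c2 := T.c2
  have k1 := braid3 T.b2 T.a2 (swap_pow_one T.a2 T.b2 T.ab)
  have k2 := braid4 T.c2 T.b2 (swap_pow_one T.b2 T.c2 T.bc)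
  have k3 := comm_of_two T.c2 T.a2 (swap_pow_one T.a2 T.c2 T.ac)
  have k1' := tail3 k1
  have k3' := tail2 k3
  set u := b * (c * b) with hu
  set v := a * (b * (c * (b * a))) with hv
  have mt : c ∈ Subgroup.closure {c, u, v} := Subgroup.subset_closure (by simp)
  have mu : u ∈ Subgroup.closure {c, u, v} := Subgroup.subset_closure (by simp)
  have mv : v ∈ Subgroup.closure {c, u, v} := Subgroup.subset_closure (by simp)
  have ui : u⁻¹ = u := by simp only [hu, mul_inv_rev, bi, ci, mul_assoc]
  have vi : v⁻¹ = v := by simp only [hv, mul_inv_rev, ai, bi, ci, mul_assoc]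
  have act : a * c * a = c := by simp only [mul_assoc, k3, A]
  have aut : a * u * a = v := by simp only [hu, hv, mul_assoc]
  have avt : a * v * a = u := by simp only [hu, hv, mul_assoc, A, a2, mul_one]
  have bct : b * c * b = u := by simp only [hu, mul_assoc]
  have but : b * u * b = c := by simp only [hu, mul_assoc, B, b2, mul_one]
  have bvt : b * v * b = v := by
    calc b * v * b = b * (a * (b * (c * (b * (a * b))))) := by simp only [hv, mul_assoc]
      _ = v := by rw [k1, k1']; simp only [hv, k3', A]
  have conj : ∀ s x y : G, s * s = 1 → x * y = y * x →
      (s * x * s) * (s * y * s) = (s * y * s) * (s * x * s) := by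
    intro s x y s2 h
    have e : ∀ x y : G, (s * x * s) * (s * y * s) = s * (x * y) * s := by
      intro x y; simp only [mul_assoc, cancel s2]
    rw [e, e, h]
  have h1 : c * u = u * c := by rw [k2]; simp only [hu, mul_assoc]
  have h2 : c * v = v * c := by
    have := conj a c u a2 h1
    rwa [act, aut] at this
  have h3 : u * v = v * u := by
    have := conj b c v b2 h2
    rwa [bct, bvt] at this
  refine torBdd_of_translations (by norm_num) T c u v 1 1 1 1 h1 h2 h3 (by simp) (by simp)
    (by simp) (by simp [ci]) (by simp [ui]) (by simp [vi]) ?_ ?_ ?_ ?_ ?_ ?_ (one_mem _)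
    (by simp) g
  · rw [act]; exact mt
  · rw [aut]; exact mv
  · rw [avt]; exact mu
  · rw [bct]; exact mu
  · rw [but]; exact mt
  · rw [bvt]; exact mv

/-- Icosahedral case: coset enumeration over the dihedral subgroup generated by `a` and `b`. -/
theorem case532 (T : Tri a b c 5 3 2) (g : G) : TorBdd g := by
  apply torBdd_of_finOrder
  have A := cancel T.a2
  have B := cancel T.b2
  have C := cancel T.c2
  have a2 := T.a2
  have b2 := T.b2
  have c2 := T.c2
  have k1 := braid5 T.b2 T.a2 (swap_pow_one T.a2 T.b2 T.ab)
  have k2 := braid3 T.c2 T.b2 (swap_pow_one T.b2 T.c2 T.bc)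
  have k3 := comm_of_two T.c2 T.a2 (swap_pow_one T.a2 T.c2 T.ac)
  have k1' := tail5 k1
  have k2' := tail3 k2
  have k3' := tail2 k3
  have k4 : c * (b * (a * c)) = b * (c * (b * a)) := by rw [← k3, k2']
  have k4' := tail4 k4
  have k5 : c * (b * (a * (b * (c * b)))) = b * (c * (b * (a * (b * c)))) := by
    rw [← k2, k4']
  have k5' := tail6 k5
  have k6 : ∀ x, c * (b * (a * (b * (a * (c * (b * (a * (b * (a * x))))))))) =
      b * (c * (b * (a * (b * (a * (c * (b * (a * (b * x))))))))) := by
    intro x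
    calc _ = c * (b * (a * (b * (c * (a * (b * (a * (b * (a * x))))))))) := by rw [k3']
      _ = c * (b * (a * (b * (c * (b * (a * (b * (a * (b * x))))))))) := by rw [← k1']
      _ = _ := by rw [k5', k3']
  let W : List G := [1, c, b * c, a * (b * c), b * (a * (b * c)), a * (b * (a * (b * c))),
    c * (b * (a * (b * c))), a * (c * (b * (a * (b * c)))), b * (a * (c * (b * (a * (b * c))))),
    a * (b * (a * (c * (b * (a * (b * c)))))), b * (a * (b * (a * (c * (b * (a * (b * c))))))),
    c * (b * (a * (b * (a * (c * (b * (a * (b * c))))))))]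
  let H := Subgroup.closure {a, b}
  have step : ∀ s ∈ ({a, b, c} : Set G), ∀ w ∈ W, ∃ w' ∈ W,
      s * w = w' ∨ s * w = w' * a ∨ s * w = w' * b := by
    intro s hs w hw
    simp only [W, List.mem_cons, List.not_mem_nil, or_false] at hw
    rcases hs with rfl | rfl | rfl <;>
    rcases hw with rfl | rfl | rfl | rfl | rfl | rfl | rfl | rfl | rfl | rfl | rfl | rfl <;>
    simp only [W, List.mem_cons, List.not_mem_nil, or_false, exists_eq_or_imp, exists_eq_left,
      mul_assoc, A, B, C, a2, b2, c2, mul_one, one_mul, k1, k1', k2, k2', k3, k3', k4, k4', k5,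
      k5', k6, true_or, or_true]
  have mA : a ∈ H := Subgroup.subset_closure (by simp)
  have mB : b ∈ H := Subgroup.subset_closure (by simp)
  have step' : ∀ s ∈ ({a, b, c} : Set G), ∀ y, (∃ w ∈ W, ∃ h ∈ H, y = w * h) →
      ∃ w ∈ W, ∃ h ∈ H, s * y = w * h := by
    rintro s hs _ ⟨w, hw, h, hh, rfl⟩
    obtain ⟨w', hw', e | e | e⟩ := step s hs w hw
    · exact ⟨w', hw', h, hh, by rw [← mul_assoc, e]⟩
    · exact ⟨w', hw', a * h, mul_mem mA hh, by rw [← mul_assoc, e, mul_assoc]⟩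
    · exact ⟨w', hw', b * h, mul_mem mB hh, by rw [← mul_assoc, e, mul_assoc]⟩
  have key : ∀ x : G, ∃ w ∈ W, ∃ h ∈ H, x = w * h := by
    intro x
    have hx : x ∈ Subgroup.closure {a, b, c} := by rw [T.gen]; trivial
    induction hx using Subgroup.closure_induction_left with
    | one => exact ⟨1, by simp [W], 1, one_mem _, by simp⟩
    | mul_left x hx y _ ih => exact step' x hx y ih
    | inv_mul_cancel x hx y _ ih =>
      have : x⁻¹ = x := by
        rcases hx with rfl | rfl | rfl <;> exact inv_eq_of_mul_eq_one_left (by assumption)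
      rw [this]; exact step' x hx y ih
  have hH : Finite H := by
    refine dihedral_finite (⟨a, mA⟩ : H) ⟨b, mB⟩ 5 (by norm_num) (Subtype.ext a2) (Subtype.ext b2)
      (Subtype.ext T.ab) ?_
    have := Subgroup.closure_closure_coe_preimage (k := ({a, b} : Set G))
    rw [← this]
    congr 1
    ext ⟨x, hx⟩
    simp
  have hfin : Finite G := by
    have : (Set.univ : Set G).Finite := by
      refine (Set.Finite.mul (List.finite_toSet W) (Set.toFinite (H : Set G))).subset fun x _ => ?_
      obtain ⟨w, hw, h, hh, rfl⟩ := key x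
      exact Set.mul_mem_mul hw hh
    exact Set.finite_univ_iff.1 this
  exact isOfFinOrder_of_finite g

theorem sorted (T : Tri a b c p q r) (hr : 2 ≤ r) (hrq : r ≤ q) (hqp : q ≤ p)
    (h : p * q * r ≤ q * r + p * r + p * q) (g : G) : TorBdd g := by
  have hr3 : r ≤ 3 := by
    by_contra hcon
    have h1 : q * r ≤ p * q := by nlinarith
    have h2 : p * r ≤ p * q := by nlinarith
    have h3 : 0 < p * q := by apply Nat.mul_pos <;> omega
    nlinarith
  obtain rfl | rfl : r = 2 ∨ r = 3 := by omega
  · have hq4 : q ≤ 4 := by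
      by_contra hcon
      have h1 : 5 * p ≤ p * q := by nlinarith
      nlinarith
    obtain rfl | rfl | rfl : q = 2 ∨ q = 3 ∨ q = 4 := by omega
    · exact T.case22 (by omega) g
    · obtain rfl | rfl | rfl | rfl : p = 3 ∨ p = 4 ∨ p = 5 ∨ p = 6 := by omega
      · exact T.case332 g
      · exact T.swap_ac.case342 g
      · exact T.case532 g
      · exact T.case632 g
    · obtain rfl : p = 4 := by omega
      exact T.case442 g
  · have hq3 : q ≤ 3 := by
      by_contra hcon
      have h1 : 4 * p ≤ p * q := by nlinarith
      nlinarith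
    obtain rfl : q = 3 := by omega
    obtain rfl : p = 3 := by omega
    exact T.case333 g

theorem torBdd (T : Tri a b c p q r) (hp : 2 ≤ p) (hq : 2 ≤ q) (hr : 2 ≤ r)
    (h : p * q * r ≤ q * r + p * r + p * q) (g : G) : TorBdd g := by
  rcases le_total p q with h1 | h1 <;> rcases le_total q r with h2 | h2 <;>
    rcases le_total p r with h3 | h3
  · exact T.swap_bc.sorted hp h1 h2 (by linarith) g
  · exact T.swap_bc.sorted hp h1 h2 (by linarith) g
  · exact T.swap_bc.swap_ac.sorted hp h3 h2 (by linarith) g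
  · exact T.swap_ac.sorted hr h3 h1 (by linarith) g
  · exact T.swap_bc.swap_ab.sorted hq h1 h3 (by linarith) g
  · exact T.swap_ab.sorted hq h2 h3 (by linarith) g
  · exact T.sorted hr h2 h1 (by linarith) g
  · exact T.sorted hr h2 h1 (by linarith) g

end Tri

theorem tri_presented (p q r : ℕ) :
    Tri (PresentedGroup.of 0 : PresentedGroup (triRels p q r)) (PresentedGroup.of 1)
      (PresentedGroup.of 2) p q r where
  a2 := by
    rw [← pow_two]
    exact PresentedGroup.one_of_mem (rels := triRels p q r) (x := FreeGroup.of 0 ^ 2)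
      (by simp [triRels])
  b2 := by
    rw [← pow_two]
    exact PresentedGroup.one_of_mem (rels := triRels p q r) (x := FreeGroup.of 1 ^ 2)
      (by simp [triRels])
  c2 := by
    rw [← pow_two]
    exact PresentedGroup.one_of_mem (rels := triRels p q r) (x := FreeGroup.of 2 ^ 2)
      (by simp [triRels])
  ab := PresentedGroup.one_of_mem (rels := triRels p q r)
    (x := (FreeGroup.of 0 * FreeGroup.of 1) ^ p) (by simp [triRels])
  bc := PresentedGroup.one_of_mem (rels := triRels p q r)
    (x := (FreeGroup.of 1 * FreeGroup.of 2) ^ q) (by simp [triRels])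
  ac := PresentedGroup.one_of_mem (rels := triRels p q r)
    (x := (FreeGroup.of 0 * FreeGroup.of 2) ^ r) (by simp [triRels])
  gen := by
    rw [← PresentedGroup.closure_range_of (triRels p q r)]
    congr 1
    ext x
    simp [Fin.exists_fin_succ, eq_comm]

theorem stmt_14 (p q r : ℕ) (hp : 2 ≤ p) (hq : 2 ≤ q) (hr : 2 ≤ r)
    (h : 1 ≤ (1 : ℝ) / p + 1 / q + 1 / r) :
    ∀ g : PresentedGroup (triRels p q r),
      swl {x : PresentedGroup (triRels p q r) | IsOfFinOrder x} g = 0 := by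
  intro g
  refine swl_zero_of_torBdd g ((tri_presented p q r).torBdd hp hq hr ?_ g)
  have hp' : (0 : ℝ) < p := by exact_mod_cast (by omega : 0 < p)
  have hq' : (0 : ℝ) < q := by exact_mod_cast (by omega : 0 < q)
  have hr' : (0 : ℝ) < r := by exact_mod_cast (by omega : 0 < r)
  have e : (1 : ℝ) / p + 1 / q + 1 / r = (q * r + p * r + p * q) / (p * q * r) := by
    field_simp
  rw [e, le_div_iff₀ (by positivity), one_mul] at h
  exact_mod_cast h
end
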